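/- Let X be a set, Y' ⊆ Y ⊆ X, n ≥ 0, and x(1),…,x(n) ∈ X∖Y pairwise distinct; put W = {x(1),…,x(n)} and W(ℓ) = W∖{x(ℓ)}. Then inside ℚ(X) one has the equality of additive subgroups (Σ_{ℓ=1}^{n} R⁺_{Y ∪ W(ℓ)}) ∩ R⁺_{Y' ∪ W} = Σ_{ℓ=1}^{n} R⁺_{Y' ∪ W(ℓ)}. -/

import Mathlib

set_option synthInstance.maxHeartbeats 1000000
set_option maxHeartbeats 1000000

/-- A multivariate integer polynomial is primitive if it is not divisible by any
integer `m > 1`. -/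
def MvPrimitive {X : Type*} (q : MvPolynomial X ℤ) : Prop :=
  ∀ m : ℤ, 1 < m → ¬ (MvPolynomial.C m ∣ q)

/-- `ℚ(X)`, the field of fractions of `ℤ[X]`. -/
abbrev FracField (X : Type*) := FractionRing (MvPolynomial X ℤ)

/-- The set of elements `p / q` of `ℚ(X)` with `p, q ∈ ℤ[X]` polynomials in the
variables from `Z` and `q` primitive. -/
def Rset (X : Type*) (Z : Set X) : Set (FracField X) :=
  {x | ∃ p q : MvPolynomial X ℤ,
      p ∈ MvPolynomial.supported ℤ Z ∧ q ∈ MvPolynomial.supported ℤ Z ∧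
      MvPrimitive q ∧
      x = algebraMap (MvPolynomial X ℤ) (FracField X) p /
          algebraMap (MvPolynomial X ℤ) (FracField X) q}

/-- `R_Z` as a subring of `ℚ(X)`; since the set `Rset X Z` is closed under the ring
operations (by Gauss's lemma), this subring is exactly `Rset X Z`. -/
noncomputable def Rsub (X : Type*) (Z : Set X) : Subring (FracField X) :=
  Subring.closure (Rset X Z)

/-- `R⁺_Z`, the additive group of `R_Z`, as an additive subgroup of `ℚ(X)`;
since the set `Rset X Z` is closed under addition and negation (by Gauss's lemma),
this additive subgroup is exactly `Rset X Z`. -/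
noncomputable def Radd (X : Type*) (Z : Set X) : AddSubgroup (FracField X) :=
  AddSubgroup.closure (Rset X Z)

section helpers
open Polynomial

theorem isUnit_mk_cyclotomic {A : Type*} [CommRing A] [IsLocalRing A] (p : ℕ)
    (hp1 : 1 ≤ p) (hp : (p : A) ∈ IsLocalRing.maximalIdeal A) (Q : A[X])
    (hQ : ∃ i, IsUnit (Q.coeff i)) :
    ∃ N0 : ℕ, ∀ N, N0 ≤ N → IsUnit (AdjoinRoot.mk (cyclotomic (p * N + 1) A) Q) := by
  classical
  let k := IsLocalRing.ResidueField A
  let K := AlgebraicClosure k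
  let res : A →+* k := IsLocalRing.residue A
  let q : K[X] := (Q.map res).map (algebraMap k K)
  have hq : q ≠ 0 := by
    obtain ⟨i, hi⟩ := hQ
    intro h
    have h2 : q.coeff i = 0 := by rw [h]; simp
    simp only [q, coeff_map] at h2
    exact ((hi.map res).map (algebraMap k K)).ne_zero h2
  refine ⟨q.roots.toFinset.sup orderOf, fun N hN => ?_⟩
  set r := p * N + 1 with hr
  have hrN : N < r := by
    rw [hr]; nlinarith
  have hpk : (p : k) = 0 := by
    have : res (p : A) = 0 := (IsLocalRing.residue_eq_zero_iff _).2 hp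
    simpa using this
  have hpK : (p : K) = 0 := by
    have := congrArg (algebraMap k K) hpk
    simpa using this
  have hrK : ((r : ℕ) : K) = 1 := by
    rw [hr]; rw [Nat.cast_add, Nat.cast_mul, hpK]; simp
  have : NeZero ((r : ℕ) : K) := ⟨by rw [hrK]; exact one_ne_zero⟩
  have hcop : IsCoprime (Q.map res) (cyclotomic r k) := by
    rw [Polynomial.isCoprime_iff_aeval_ne_zero_of_isAlgClosed k K]
    intro a
    by_contra! h
    obtain ⟨h1, h2⟩ := h
    have ha : a ∈ q.roots.toFinset := by
      rw [Multiset.mem_toFinset, mem_roots hq, IsRoot.def]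
      simpa [q, aeval_def, eval_map] using h1
    have hprim : IsPrimitiveRoot a r := by
      rw [← isRoot_cyclotomic_iff, IsRoot.def, ← map_cyclotomic r (algebraMap k K), eval_map]
      exact h2
    have h3 := Finset.le_sup (f := orderOf) ha
    rw [← hprim.eq_orderOf] at h3
    omega
  by_contra hun
  obtain ⟨M, hM, hmem⟩ := exists_max_ideal_of_mem_nonunits hun
  have hmon := cyclotomic.monic r A
  have := hmon.finite_adjoinRoot
  have hmax : (M.comap (algebraMap A (AdjoinRoot (cyclotomic r A)))).IsMaximal :=
    Ideal.isMaximal_comap_of_isIntegral_of_isMaximal M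
  have heq := IsLocalRing.eq_maximalIdeal hmax
  let B := AdjoinRoot (cyclotomic r A)
  let L := B ⧸ M
  let f : A →+* L := (Ideal.Quotient.mk M).comp (algebraMap A B)
  have hf : ∀ a ∈ IsLocalRing.maximalIdeal A, f a = 0 := by
    intro a ha
    rw [← heq] at ha
    exact Ideal.Quotient.eq_zero_iff_mem.2 ha
  let g : k →+* L := Ideal.Quotient.lift (IsLocalRing.maximalIdeal A) f hf
  have hg : g.comp res = f := by
    ext a; rfl
  obtain ⟨u, v, huv⟩ := hcop
  let t : L := Ideal.Quotient.mk M (AdjoinRoot.root _)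
  have key := congrArg (eval₂ g t) huv
  have e : ∀ P : A[X], eval₂ f t P = Ideal.Quotient.mk M (AdjoinRoot.mk _ P) := by
    intro P
    have : (eval₂RingHom f t) = (Ideal.Quotient.mk M).comp (AdjoinRoot.mk (cyclotomic r A)) := by
      apply Polynomial.ringHom_ext
      · intro a; simp [f]; rfl
      · simp [t]
    exact congrArg (fun h => h P) this
  have h1 : eval₂ g t (Q.map res) = 0 := by
    rw [eval₂_map, hg, e]; exact Ideal.Quotient.eq_zero_iff_mem.2 hmem
  have h2 : eval₂ g t (cyclotomic r k) = 0 := by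
    rw [← map_cyclotomic r res, eval₂_map, hg, e]; simp
  rw [eval₂_add, eval₂_mul, eval₂_mul, h1, h2] at key
  have : Nontrivial L := Ideal.Quotient.nontrivial_iff.2 hM.ne_top
  simp at key

end helpers

section helpers2
open MvPolynomial

theorem prime_C_int {X : Type*} {p : ℕ} (hp : p.Prime) :
    Prime (C (p : ℤ) : MvPolynomial X ℤ) :=
  (MvPolynomial.prime_C_iff _).2 (Nat.prime_iff_prime_int.1 hp)

/-- The localized version of `Rset`, as a subring. -/
def Aloc (X : Type*) (p : ℕ) (hp : p.Prime) (Z : Set X) : Subring (FracField X) where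
  carrier := {x | ∃ a b : MvPolynomial X ℤ,
      a ∈ supported ℤ Z ∧ b ∈ supported ℤ Z ∧ ¬ (C (p : ℤ) ∣ b) ∧
      x = algebraMap (MvPolynomial X ℤ) (FracField X) a /
          algebraMap (MvPolynomial X ℤ) (FracField X) b}
  zero_mem' := ⟨0, 1, zero_mem _, one_mem _, (prime_C_int hp).not_dvd_one, by simp⟩
  one_mem' := ⟨1, 1, one_mem _, one_mem _, (prime_C_int hp).not_dvd_one, by simp⟩
  add_mem' := by
    rintro _ _ ⟨a, b, ha, hb, hpb, rfl⟩ ⟨a', b', ha', hb', hpb', rfl⟩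
    refine ⟨a * b' + b * a', b * b', add_mem (mul_mem ha hb') (mul_mem hb ha'), mul_mem hb hb',
      fun h => ((prime_C_int hp).dvd_or_dvd h).elim hpb hpb', ?_⟩
    have h1 : algebraMap (MvPolynomial X ℤ) (FracField X) b ≠ 0 := by
      rw [ne_eq, FaithfulSMul.algebraMap_eq_zero_iff]; rintro rfl; simp at hpb
    have h2 : algebraMap (MvPolynomial X ℤ) (FracField X) b' ≠ 0 := by
      rw [ne_eq, FaithfulSMul.algebraMap_eq_zero_iff]; rintro rfl; simp at hpb'
    rw [div_add_div _ _ h1 h2]; simp only [map_add, map_mul]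
  mul_mem' := by
    rintro _ _ ⟨a, b, ha, hb, hpb, rfl⟩ ⟨a', b', ha', hb', hpb', rfl⟩
    refine ⟨a * a', b * b', mul_mem ha ha', mul_mem hb hb',
      fun h => ((prime_C_int hp).dvd_or_dvd h).elim hpb hpb', ?_⟩
    rw [div_mul_div_comm]; simp only [map_mul]
  neg_mem' := by
    rintro _ ⟨a, b, ha, hb, hpb, rfl⟩
    exact ⟨-a, b, neg_mem ha, hb, hpb, by rw [map_neg, neg_div]⟩

variable {X : Type*} {p : ℕ} (hp : p.Prime)

theorem Aloc_mono {Z Z' : Set X} (h : Z ⊆ Z') : Aloc X p hp Z ≤ Aloc X p hp Z' := by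
  rintro _ ⟨a, b, ha, hb, hpb, rfl⟩
  exact ⟨a, b, supported_mono h ha, supported_mono h hb, hpb, rfl⟩

theorem algebraMap_mem_Aloc {Z : Set X} {a : MvPolynomial X ℤ} (ha : a ∈ supported ℤ Z) :
    algebraMap (MvPolynomial X ℤ) (FracField X) a ∈ Aloc X p hp Z :=
  ⟨a, 1, ha, one_mem _, (prime_C_int hp).not_dvd_one, by simp⟩

theorem algMap_ne_zero {b : MvPolynomial X ℤ} (hpb : ¬ (C (p : ℤ) ∣ b)) :
    algebraMap (MvPolynomial X ℤ) (FracField X) b ≠ 0 := by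
  rw [ne_eq, FaithfulSMul.algebraMap_eq_zero_iff]; rintro rfl; simp at hpb

theorem supported_of_C_mul {Z : Set X} {m : ℤ} (hm : m ≠ 0) {a : MvPolynomial X ℤ}
    (h : C m * a ∈ supported ℤ Z) : a ∈ supported ℤ Z := by
  rw [mem_supported, vars_C_mul _ hm] at h
  exact mem_supported.2 h

theorem algMap_C_nat (m : ℕ) :
    algebraMap (MvPolynomial X ℤ) (FracField X) (C (m : ℤ)) = (m : FracField X) := by
  simp

theorem Aloc_isUnit_or_dvd {Z : Set X} (h : Aloc X p hp Z) :
    IsUnit h ∨ (p : Aloc X p hp Z) ∣ h := by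
  obtain ⟨_, a, b, ha, hb, hpb, rfl⟩ := h
  by_cases hpa : C (p : ℤ) ∣ a
  · right
    obtain ⟨a1, rfl⟩ := hpa
    refine ⟨⟨_, a1, b, supported_of_C_mul (by exact_mod_cast hp.ne_zero) ha, hb, hpb, rfl⟩, ?_⟩
    apply Subtype.ext
    simp only [map_mul, algMap_C_nat, Subring.coe_mul, Subring.coe_natCast, mul_div_assoc]
  · left
    refine IsUnit.of_mul_eq_one ⟨_, b, a, hb, ha, hpa, rfl⟩ ?_
    apply Subtype.ext
    have h1 := algMap_ne_zero hpb
    have h2 := algMap_ne_zero hpa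
    simp only [Subring.coe_mul, Subring.coe_one]
    field_simp

theorem not_p_mul_mem {Z : Set X} {e : FracField X} (he : e ∈ Aloc X p hp Z)
    {b : MvPolynomial X ℤ} (hpb : ¬ (C (p : ℤ) ∣ b)) :
    algebraMap (MvPolynomial X ℤ) (FracField X) b ≠ p * e := by
  obtain ⟨a', b', ha, hb, hpb', rfl⟩ := he
  intro h
  have h1 := algMap_ne_zero hpb'
  rw [← algMap_C_nat, ← mul_div_assoc, eq_div_iff h1, ← map_mul, ← map_mul] at h
  have h := FaithfulSMul.algebraMap_injective _ _ h
  exact ((prime_C_int hp).dvd_or_dvd (Dvd.intro _ h.symm)).elim hpb hpb'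

theorem Aloc_not_dvd_one {Z : Set X} : ¬ ((p : Aloc X p hp Z) ∣ 1) := by
  rintro ⟨e, he⟩
  have := not_p_mul_mem hp e.2 (prime_C_int (X := X) hp).not_dvd_one
  apply this
  have := congrArg Subtype.val he
  simpa using this

instance Aloc_local {Z : Set X} : IsLocalRing (Aloc X p hp Z) := by
  apply IsLocalRing.of_isUnit_or_isUnit_one_sub_self
  intro a
  rcases Aloc_isUnit_or_dvd hp a with h | h
  · exact Or.inl h
  rcases Aloc_isUnit_or_dvd hp (1 - a) with h' | h'
  · exact Or.inr h'
  have h3 := dvd_add h h'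
  rw [add_sub_cancel] at h3
  exact absurd h3 (Aloc_not_dvd_one hp)

theorem Aloc_p_mem {Z : Set X} :
    (p : Aloc X p hp Z) ∈ IsLocalRing.maximalIdeal (Aloc X p hp Z) := by
  rw [IsLocalRing.mem_maximalIdeal, mem_nonunits_iff]
  intro h
  exact Aloc_not_dvd_one hp h.dvd

/-- Substitution of the variable `y` by a polynomial variable. -/
noncomputable def phi (y : X) : MvPolynomial X ℤ →+* Polynomial (FracField X) :=
  open Classical in
  eval₂Hom (Int.castRingHom _) (fun i => if i = y then Polynomial.X else
    Polynomial.C (algebraMap (MvPolynomial X ℤ) (FracField X) (MvPolynomial.X i)))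

theorem eval_phi (y : X) (b : MvPolynomial X ℤ) :
    (phi y b).eval (algebraMap (MvPolynomial X ℤ) (FracField X) (MvPolynomial.X y)) =
      algebraMap (MvPolynomial X ℤ) (FracField X) b := by
  have : (Polynomial.evalRingHom (algebraMap (MvPolynomial X ℤ) (FracField X) (MvPolynomial.X y))).comp
      (phi y) = algebraMap (MvPolynomial X ℤ) (FracField X) := by
    apply MvPolynomial.ringHom_ext
    · intro r; simp [phi]
    · intro i
      by_cases h : i = y
      · subst h; simp [phi]
      · simp [phi, h]
  exact congrArg (fun h => h b) this

theorem phi_const {y : X} {Z : Set X} (hy : y ∉ Z) {b : MvPolynomial X ℤ}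
    (hb : b ∈ supported ℤ Z) :
    phi y b = Polynomial.C (algebraMap (MvPolynomial X ℤ) (FracField X) b) := by
  induction hb using Algebra.adjoin_induction with
  | mem b hb =>
    obtain ⟨i, hi, rfl⟩ := hb
    have : i ≠ y := by rintro rfl; exact hy hi
    simp [phi, this]
  | algebraMap r => simp
  | add a b _ _ ha hb => simp only [map_add, ha, hb]
  | mul a b _ _ ha hb => simp only [map_mul, ha, hb]

theorem phi_lift {y : X} {Z : Set X} {b : MvPolynomial X ℤ}
    (hb : b ∈ supported ℤ (insert y Z)) :
    ∃ P : Polynomial (Aloc X p hp Z), P.map (Aloc X p hp Z).subtype = phi y b := by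
  induction hb using Algebra.adjoin_induction with
  | mem b hb =>
    obtain ⟨i, hi, rfl⟩ := hb
    by_cases h : i = y
    · exact ⟨Polynomial.X, by simp [phi, h]⟩
    · have hi' : i ∈ Z := hi.resolve_left h
      exact ⟨Polynomial.C ⟨_, algebraMap_mem_Aloc hp (X_mem_supported.2 hi')⟩, by simp [phi, h]⟩
  | algebraMap r => exact ⟨(r : Polynomial _), by simp⟩
  | add a b _ _ ha hb =>
    obtain ⟨P, hP⟩ := ha
    obtain ⟨Q, hQ⟩ := hb
    exact ⟨P + Q, by rw [Polynomial.map_add, hP, hQ, map_add]⟩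
  | mul a b _ _ ha hb =>
    obtain ⟨P, hP⟩ := ha
    obtain ⟨Q, hQ⟩ := hb
    exact ⟨P * Q, by rw [Polynomial.map_mul, hP, hQ, map_mul]⟩

theorem exists_unit_coeff {y : X} {Z : Set X} {b : MvPolynomial X ℤ}
    (hpb : ¬ (C (p : ℤ) ∣ b)) (Q : Polynomial (Aloc X p hp Z))
    (hQ : Q.map (Aloc X p hp Z).subtype = phi y b) : ∃ i, IsUnit (Q.coeff i) := by
  by_contra! h
  have h1 : Polynomial.C (p : Aloc X p hp Z) ∣ Q := by
    rw [Polynomial.C_dvd_iff_dvd_coeff]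
    exact fun i => (Aloc_isUnit_or_dvd hp _).resolve_left (h i)
  obtain ⟨Q', rfl⟩ := h1
  have h2 := eval_phi y b
  rw [← hQ, Polynomial.map_mul, Polynomial.eval_mul, Polynomial.map_C, Polynomial.eval_C] at h2
  have h3 : ((Q'.map (Aloc X p hp Z).subtype).eval
      (algebraMap (MvPolynomial X ℤ) (FracField X) (MvPolynomial.X y))) ∈ Aloc X p hp Set.univ := by
    rw [Polynomial.eval_eq_sum_range]
    refine sum_mem fun i _ => mul_mem ?_ (pow_mem (algebraMap_mem_Aloc hp (by simp)) _)
    rw [Polynomial.coeff_map]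
    exact Aloc_mono hp (Set.subset_univ _) (Q'.coeff i).2
  apply not_p_mul_mem hp h3 hpb
  rw [← h2]; simp

/-- Fraction `z` specializes to `w` along `ψ`. -/
def SpecRel {B : Type*} [CommRing B] (ψ : MvPolynomial X ℤ →+* B) (z : FracField X) (w : B) :
    Prop :=
  ∃ a b : MvPolynomial X ℤ, b ≠ 0 ∧ IsUnit (ψ b) ∧
    z * algebraMap _ (FracField X) b = algebraMap _ (FracField X) a ∧ w * ψ b = ψ a

theorem SpecRel.add {B : Type*} [CommRing B] {ψ : MvPolynomial X ℤ →+* B} {z z' : FracField X}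
    {w w' : B} (h : SpecRel ψ z w) (h' : SpecRel ψ z' w') : SpecRel ψ (z + z') (w + w') := by
  obtain ⟨a, b, hb, hu, h1, h2⟩ := h
  obtain ⟨a', b', hb', hu', h1', h2'⟩ := h'
  refine ⟨a * b' + a' * b, b * b', mul_ne_zero hb hb', by rw [map_mul]; exact hu.mul hu', ?_, ?_⟩
  · simp only [map_mul, map_add, ← h1, ← h1']; ring
  · simp only [map_mul, map_add, ← h2, ← h2']; ring

theorem SpecRel.sum {B : Type*} [CommRing B] {ψ : MvPolynomial X ℤ →+* B} {ι : Type*}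
    (s : Finset ι) {z : ι → FracField X}
    {w : ι → B} (h : ∀ i, SpecRel ψ (z i) (w i)) : SpecRel ψ (∑ i ∈ s, z i) (∑ i ∈ s, w i) := by
  classical
  induction s using Finset.induction_on with
  | empty => exact ⟨0, 1, one_ne_zero, by simp, by simp, by simp⟩
  | insert i s hi ih => rw [Finset.sum_insert hi, Finset.sum_insert hi]; exact (h i).add ih

theorem SpecRel.unique {B : Type*} [CommRing B] {ψ : MvPolynomial X ℤ →+* B} {z : FracField X}
    {w w' : B} (h : SpecRel ψ z w) (h' : SpecRel ψ z w') : w = w' := by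
  obtain ⟨a, b, hb, hu, h1, h2⟩ := h
  obtain ⟨a', b', hb', hu', h1', h2'⟩ := h'
  have h3 : a * b' = a' * b := by
    apply FaithfulSMul.algebraMap_injective (MvPolynomial X ℤ) (FracField X)
    rw [map_mul, map_mul, ← h1, ← h1']; ring
  have h4 := congrArg ψ h3
  rw [map_mul, map_mul, ← h2, ← h2'] at h4
  apply (hu.mul hu').mul_right_cancel
  linear_combination h4

theorem one_step {ι : Type*} [Fintype ι] (Zs : ι → Set X) (Z : Set X) (y : X) (hy : y ∉ Z)
    (f : FracField X) (hf : f ∈ Aloc X p hp Z)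
    (g : ι → FracField X) (hg : ∀ i, g i ∈ Aloc X p hp (insert y (Zs i)))
    (hfg : f = ∑ i, g i) :
    ∃ h : ι → FracField X, (∀ i, h i ∈ Aloc X p hp (Zs i)) ∧ f = ∑ i, h i := by
  choose a b ha hb hpb hab using hg
  choose P hP using fun i => phi_lift hp (ha i)
  choose Q hQ using fun i => phi_lift hp (hb i)
  choose N0 hN0 using fun i => isUnit_mk_cyclotomic p hp.one_le (Aloc_p_mem hp) (Q i)
    (exists_unit_coeff hp (hpb i) (Q i) (hQ i))
  set N := Finset.univ.sup N0 with hN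
  set r := p * N + 1 with hr
  have hun : ∀ i, IsUnit (AdjoinRoot.mk (Polynomial.cyclotomic r (Aloc X p hp (Zs i))) (Q i)) :=
    fun i => hN0 i N (Finset.le_sup (Finset.mem_univ i))
  have hU : ∀ i, ∃ U V : Polynomial (Aloc X p hp (Zs i)),
      Q i * U - 1 = Polynomial.cyclotomic r _ * V := by
    intro i
    obtain ⟨u, hu⟩ := (hun i).exists_right_inv
    obtain ⟨U, rfl⟩ := AdjoinRoot.mk_surjective u
    refine ⟨U, ?_⟩
    rw [← map_mul, ← map_one (AdjoinRoot.mk _), AdjoinRoot.mk_eq_mk] at hu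
    exact hu
  choose U V hUV using hU
  set G := Polynomial.cyclotomic r (FracField X) with hG
  have hGm : G.Monic := Polynomial.cyclotomic.monic _ _
  let ψ : MvPolynomial X ℤ →+* AdjoinRoot G := (AdjoinRoot.mk G).comp (phi y)
  let H : ∀ i, Polynomial (Aloc X p hp (Zs i)) := fun i => P i * U i
  have r1 : ∀ i, SpecRel ψ (g i)
      (AdjoinRoot.mk G ((H i).map (Aloc X p hp (Zs i)).subtype)) := by
    intro i
    have hb0 : b i ≠ 0 := by
      intro h; apply hpb i; rw [h]; exact dvd_zero _
    have e : ψ (b i) * AdjoinRoot.mk G ((U i).map (Aloc X p hp (Zs i)).subtype) = 1 := by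
      change AdjoinRoot.mk G (phi y (b i)) * _ = 1
      rw [← map_mul, ← map_one (AdjoinRoot.mk G), AdjoinRoot.mk_eq_mk, ← hQ i]
      have := congrArg (Polynomial.map (Aloc X p hp (Zs i)).subtype) (hUV i)
      rw [Polynomial.map_sub, Polynomial.map_mul, Polynomial.map_mul, Polynomial.map_cyclotomic,
        Polynomial.map_one] at this
      exact ⟨_, this⟩
    refine ⟨a i, b i, hb0, IsUnit.of_mul_eq_one _ e, ?_, ?_⟩
    · rw [hab i, div_mul_cancel₀ _ (algMap_ne_zero (hpb i))]
    · rw [Polynomial.map_mul, hP, map_mul]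
      change ψ (a i) * _ * _ = _
      linear_combination ψ (a i) * e
  have r2 : SpecRel ψ f (AdjoinRoot.mk G (Polynomial.C f)) := by
    obtain ⟨c, d, hc, hd, hpd, hcd⟩ := hf
    have hd0 : d ≠ 0 := by
      intro h; apply hpd; rw [h]; exact dvd_zero _
    have e : f * algebraMap _ (FracField X) d = algebraMap _ (FracField X) c := by
      rw [hcd, div_mul_cancel₀ _ (algMap_ne_zero hpd)]
    refine ⟨c, d, hd0, ?_, e, ?_⟩
    · change IsUnit (AdjoinRoot.mk G (phi y d))
      rw [phi_const hy hd]
      exact ((Ne.isUnit (algMap_ne_zero hpd)).map Polynomial.C).map _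
    · change _ * AdjoinRoot.mk G (phi y d) = AdjoinRoot.mk G (phi y c)
      rw [phi_const hy hd, phi_const hy hc, ← map_mul, ← map_mul, e]
  have r3 := SpecRel.sum Finset.univ r1
  rw [← hfg] at r3
  have r4 := r2.unique r3
  rw [← map_sum, AdjoinRoot.mk_eq_mk] at r4
  have r5 : Polynomial.C f %ₘ G =
      (∑ i, (H i).map (Aloc X p hp (Zs i)).subtype) %ₘ G := by
    rw [← sub_eq_zero, ← Polynomial.sub_modByMonic]
    exact (Polynomial.modByMonic_eq_zero_iff_dvd hGm).2 r4
  have hdeg : (0 : WithBot ℕ) < G.degree := by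
    rw [hG]; exact Polynomial.degree_cyclotomic_pos _ _ (by omega)
  rw [(Polynomial.modByMonic_eq_self_iff hGm).2
    (lt_of_le_of_lt Polynomial.degree_C_le hdeg)] at r5
  refine ⟨fun i => (((H i) %ₘ (Polynomial.cyclotomic r _)).coeff 0 : Aloc X p hp (Zs i)),
    fun i => Subtype.property _, ?_⟩
  have r6 := congrArg (fun q => Polynomial.coeff q 0) r5
  simp only [Polynomial.coeff_C_zero] at r6
  rw [r6]
  have : (∑ i, (H i).map (Aloc X p hp (Zs i)).subtype) %ₘ G =
      ∑ i, ((H i).map (Aloc X p hp (Zs i)).subtype) %ₘ G := by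
    exact map_sum (Polynomial.modByMonicHom G) _ _
  rw [this, Polynomial.finsetSum_coeff]
  refine Finset.sum_congr rfl fun i _ => ?_
  rw [hG, ← Polynomial.map_cyclotomic r (Aloc X p hp (Zs i)).subtype,
    ← Polynomial.map_modByMonic _ (Polynomial.cyclotomic.monic _ _), Polynomial.coeff_map]
  rfl

end helpers2

section helpers3
open MvPolynomial

variable {X : Type*} {p : ℕ} (hp : p.Prime)

theorem Radd_le_Aloc (Z : Set X) : Radd X Z ≤ (Aloc X p hp Z).toAddSubgroup := by
  rw [Radd, AddSubgroup.closure_le]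
  rintro _ ⟨a, b, ha, hb, hpb, rfl⟩
  exact ⟨a, b, ha, hb, hpb _ (by exact_mod_cast hp.one_lt), rfl⟩

theorem Radd_mono {Z Z' : Set X} (h : Z ⊆ Z') : Radd X Z ≤ Radd X Z' := by
  apply AddSubgroup.closure_mono
  rintro _ ⟨a, b, ha, hb, hpb, rfl⟩
  exact ⟨a, b, supported_mono h ha, supported_mono h hb, hpb, rfl⟩

theorem exists_primitive {Z : Set X} (n : ℕ) : ∀ (b : MvPolynomial X ℤ) (i : X →₀ ℕ),
    (b.coeff i).natAbs = n → b.coeff i ≠ 0 → b ∈ supported ℤ Z → ¬ (C (p : ℤ) ∣ b) →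
    ∃ (m : ℤ) (b' : MvPolynomial X ℤ), b = C m * b' ∧ ¬ ((p : ℤ) ∣ m) ∧
      b' ∈ supported ℤ Z ∧ MvPrimitive b' := by
  induction n using Nat.strong_induction_on with
  | _ n ih =>
    intro b i hn hi hb hpb
    by_cases hprim : MvPrimitive b
    · refine ⟨1, b, by simp, ?_, hb, hprim⟩
      intro h
      apply hpb
      have : C (p : ℤ) ∣ (C 1 : MvPolynomial X ℤ) := map_dvd C h
      rw [C_1] at this
      exact this.trans (one_dvd _)
    · unfold MvPrimitive at hprim
      push Not at hprim
      obtain ⟨m, hm, b1, rfl⟩ := hprim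
      rw [coeff_C_mul] at hn hi
      have hi1 : b1.coeff i ≠ 0 := right_ne_zero_of_mul hi
      have hlt : (b1.coeff i).natAbs < n := by
        rw [← hn, Int.natAbs_mul]
        have h1 : 1 < m.natAbs := by omega
        have h2 : 0 < (b1.coeff i).natAbs := Int.natAbs_pos.2 hi1
        nlinarith
      obtain ⟨m', b', h1, h2, h3, h4⟩ := ih _ hlt b1 i rfl hi1
        (supported_of_C_mul (by omega) hb) (fun h => hpb (h.mul_left _))
      refine ⟨m * m', b', by rw [h1, C_mul, mul_assoc], ?_, h3, h4⟩
      intro h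
      apply hpb
      have : C (p : ℤ) ∣ (C (m * m') : MvPolynomial X ℤ) := map_dvd C h
      rw [h1, ← mul_assoc, ← C_mul]
      exact this.mul_right _

theorem exists_mul_mem_Radd {Z : Set X} {f : FracField X} (hf : f ∈ Aloc X p hp Z) :
    ∃ m : ℤ, ¬ ((p : ℤ) ∣ m) ∧ m • f ∈ Radd X Z := by
  obtain ⟨a, b, ha, hb, hpb, rfl⟩ := hf
  have hb0 : b ≠ 0 := by rintro rfl; exact hpb (dvd_zero _)
  obtain ⟨i, hi⟩ := MvPolynomial.ne_zero_iff.1 hb0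
  obtain ⟨m, b', rfl, h2, h3, h4⟩ := exists_primitive _ b i rfl hi hb hpb
  refine ⟨m, h2, AddSubgroup.subset_closure ⟨a, b', ha, h3, h4, ?_⟩⟩
  have hne := algMap_ne_zero hpb
  have e : algebraMap (MvPolynomial X ℤ) (FracField X) (C m) = (m : FracField X) := by simp
  rw [map_mul, e] at hne ⊢
  rw [zsmul_eq_mul, ← mul_div_assoc]
  exact mul_div_mul_left _ _ (left_ne_zero_of_mul hne)

theorem local_global {S : AddSubgroup (FracField X)} {f : FracField X}
    (h : ∀ p : ℕ, p.Prime → ∃ m : ℤ, ¬ ((p : ℤ) ∣ m) ∧ m • f ∈ S) : f ∈ S := by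
  let I : Ideal ℤ :=
    { carrier := {m | m • f ∈ S}
      zero_mem' := by simp
      add_mem' := by
        intro a b ha hb
        simp only [Set.mem_ofPred_eq, add_smul] at *
        exact add_mem ha hb
      smul_mem' := by
        intro c a ha
        simp only [Set.mem_ofPred_eq, smul_eq_mul, mul_smul] at *
        exact S.zsmul_mem ha c }
  obtain ⟨d, hd⟩ := (IsPrincipalIdealRing.principal I).principal
  have hmem : ∀ m : ℤ, m • f ∈ S ↔ d ∣ m := by
    intro m
    have : m ∈ I ↔ d ∣ m := by
      rw [hd]; exact Ideal.mem_span_singleton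
    exact this
  have h1 : d.natAbs = 1 := by
    by_contra hne
    obtain ⟨p, hp, hpd⟩ := Nat.exists_prime_and_dvd hne
    obtain ⟨m, hm, hmS⟩ := h p hp
    exact hm ((Int.natCast_dvd.2 hpd).trans ((hmem m).1 hmS))
  have := (hmem 1).2 (Int.natAbs_dvd.1 (by rw [h1]; simp))
  simpa using this

theorem exists_sum_of_mem_iSup {ι : Type*} [Fintype ι] (S : ι → AddSubgroup (FracField X))
    {f : FracField X} (hf : f ∈ ⨆ i, S i) :
    ∃ g : ι → FracField X, (∀ i, g i ∈ S i) ∧ f = ∑ i, g i := by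
  classical
  refine AddSubgroup.iSup_induction S (C := fun f => ∃ g : ι → FracField X, (∀ i, g i ∈ S i) ∧ f = ∑ i, g i) hf ?_ ?_ ?_
  · intro i x hx
    refine ⟨Pi.single i x, fun j => ?_, ?_⟩
    · by_cases h : j = i
      · subst h; simpa using hx
      · rw [Pi.single_eq_of_ne h]; exact zero_mem _
    · simp
  · exact ⟨0, fun i => zero_mem _, by simp⟩
  · intro x y hx hy
    obtain ⟨g, hg, rfl⟩ := hx
    obtain ⟨g', hg', rfl⟩ := hy
    exact ⟨g + g', fun i => add_mem (hg i) (hg' i), by simp [Finset.sum_add_distrib]⟩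

theorem descend (Y' : Set X) {n : ℕ} (W : Set X) (Ws : Fin n → Set X)
    (f : FracField X) (hf : f ∈ Aloc X p hp (Y' ∪ W)) (T : Finset X)
    (hT : ∀ t ∈ T, t ∉ W)
    (h : f ∈ ⨆ i, (Aloc X p hp ((Y' ∪ T) ∪ Ws i)).toAddSubgroup) :
    f ∈ ⨆ i, (Aloc X p hp (Y' ∪ Ws i)).toAddSubgroup := by
  classical
  induction T using Finset.induction_on with
  | empty => simpa using h
  | insert y T hy ih =>
    apply ih (fun t ht => hT t (Finset.mem_insert_of_mem ht))
    have hset : ∀ i, (Y' ∪ ((insert y T : Finset X) : Set X)) ∪ Ws i =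
        insert y ((Y' ∪ T) ∪ Ws i) := by
      intro i; ext z; simp; tauto
    simp only [hset] at h
    by_cases hyY : y ∈ Y'
    · have : ∀ i, insert y ((Y' ∪ (T : Set X)) ∪ Ws i) = (Y' ∪ T) ∪ Ws i :=
        fun i => Set.insert_eq_of_mem (Or.inl (Or.inl hyY))
      simpa only [this] using h
    obtain ⟨g, hg, hfg⟩ := exists_sum_of_mem_iSup _ h
    have hyZ : y ∉ Y' ∪ W := by
      rintro (h | h)
      · exact hyY h
      · exact hT y (Finset.mem_insert_self _ _) h
    obtain ⟨k, hk, hfk⟩ := one_step hp (fun i => (Y' ∪ (T : Set X)) ∪ Ws i) _ y hyZ f hf g hg hfg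
    rw [hfk]
    exact sum_mem fun i _ => AddSubgroup.mem_iSup_of_mem i (hk i)

theorem finite_vars (Y' Y : Set X) {n : ℕ} (Ws : Fin n → Set X)
    (f : FracField X) (h : f ∈ ⨆ i, (Aloc X p hp (Y ∪ Ws i)).toAddSubgroup) :
    ∃ T : Finset X, (T : Set X) ⊆ Y ∧
      f ∈ ⨆ i, (Aloc X p hp ((Y' ∪ T) ∪ Ws i)).toAddSubgroup := by
  classical
  have mono : ∀ T T' : Finset X, T ⊆ T' →
      (⨆ i, (Aloc X p hp ((Y' ∪ T) ∪ Ws i)).toAddSubgroup) ≤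
      ⨆ i, (Aloc X p hp ((Y' ∪ T') ∪ Ws i)).toAddSubgroup := by
    intro T T' hTT
    apply iSup_mono
    intro i
    exact Aloc_mono hp (Set.union_subset_union_left _
      (Set.union_subset_union_right _ (Finset.coe_subset.2 hTT)))
  refine AddSubgroup.iSup_induction _ (C := fun f => ∃ T : Finset X, (T : Set X) ⊆ Y ∧
      f ∈ ⨆ i, (Aloc X p hp ((Y' ∪ T) ∪ Ws i)).toAddSubgroup) h ?_ ?_ ?_
  · intro i x hx
    obtain ⟨a, b, ha, hb, hpb, rfl⟩ := hx
    rw [mem_supported] at ha hb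
    refine ⟨(a.vars ∪ b.vars).filter (· ∈ Y), ?_, AddSubgroup.mem_iSup_of_mem i
      ⟨a, b, ?_, ?_, hpb, rfl⟩⟩
    · intro z hz; simp at hz; exact hz.2
    · rw [mem_supported]
      intro z hz
      rcases ha hz with h | h
      · left; right
        simp only [Finset.coe_filter, Finset.mem_union, Set.mem_ofPred_eq]
        exact ⟨Or.inl hz, h⟩
      · exact Or.inr h
    · rw [mem_supported]
      intro z hz
      rcases hb hz with h | h
      · left; right
        simp only [Finset.coe_filter, Finset.mem_union, Set.mem_ofPred_eq]
        exact ⟨Or.inr hz, h⟩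
      · exact Or.inr h
  · exact ⟨∅, by simp, zero_mem _⟩
  · intro x y hx hy
    obtain ⟨T, hT, h1⟩ := hx
    obtain ⟨T', hT', h1'⟩ := hy
    refine ⟨T ∪ T', by rw [Finset.coe_union]; exact Set.union_subset hT hT', add_mem ?_ ?_⟩
    · exact mono _ _ Finset.subset_union_left h1
    · exact mono _ _ Finset.subset_union_right h1'

theorem mul_mem_iSup {n : ℕ} (Zs : Fin n → Set X) (f : FracField X)
    (h : f ∈ ⨆ i, (Aloc X p hp (Zs i)).toAddSubgroup) :
    ∃ m : ℤ, ¬ ((p : ℤ) ∣ m) ∧ m • f ∈ ⨆ i, Radd X (Zs i) := by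
  have hpp := Nat.prime_iff_prime_int.1 hp
  refine AddSubgroup.iSup_induction _ (C := fun f => ∃ m : ℤ, ¬ ((p : ℤ) ∣ m) ∧
    m • f ∈ ⨆ i, Radd X (Zs i)) h ?_ ?_ ?_
  · intro i x hx
    obtain ⟨m, hm, h⟩ := exists_mul_mem_Radd hp hx
    exact ⟨m, hm, AddSubgroup.mem_iSup_of_mem i h⟩
  · exact ⟨1, hpp.not_dvd_one, by simp⟩
  · intro x y hx hy
    obtain ⟨m, hm, h1⟩ := hx
    obtain ⟨m', hm', h1'⟩ := hy
    refine ⟨m * m', fun h => (hpp.dvd_or_dvd h).elim hm hm', ?_⟩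
    rw [zsmul_add]
    refine add_mem ?_ ?_
    · rw [mul_comm, mul_smul]; exact AddSubgroup.zsmul_mem _ h1 _
    · rw [mul_smul]; exact AddSubgroup.zsmul_mem _ h1' _

end helpers3

/-- Let `Y' ⊆ Y ⊆ X` and `x 1, …, x n ∈ X \ Y` pairwise distinct;
put `W = {x 1, …, x n}` and `W(ℓ) = W \ {x ℓ}`.  Then inside `ℚ(X)`,
`(Σ_ℓ R⁺_{Y ∪ W(ℓ)}) ∩ R⁺_{Y' ∪ W} = Σ_ℓ R⁺_{Y' ∪ W(ℓ)}`. -/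
theorem inf_sup_eq {X : Type*} (Y' Y : Set X) (hYY : Y' ⊆ Y)
    (n : ℕ) (x : Fin n → X)
    (hinj : Function.Injective x) (hxY : ∀ i, x i ∉ Y) :
    (⨆ ℓ : Fin n, Radd X (Y ∪ (Set.range x \ {x ℓ}))) ⊓
        Radd X (Y' ∪ Set.range x) =
      ⨆ ℓ : Fin n, Radd X (Y' ∪ (Set.range x \ {x ℓ})) := by
  apply le_antisymm
  · rintro f ⟨h1, h2⟩
    apply local_global
    intro p hp
    apply mul_mem_iSup hp
    have h1' : f ∈ ⨆ ℓ : Fin n,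
        (Aloc X p hp (Y ∪ (Set.range x \ {x ℓ}))).toAddSubgroup :=
      iSup_mono (fun ℓ => Radd_le_Aloc hp _) h1
    obtain ⟨T, hT, h3⟩ := finite_vars hp Y' Y _ f h1'
    refine descend hp Y' (Set.range x) _ f (Radd_le_Aloc hp _ h2) T ?_ h3
    rintro t ht ⟨i, rfl⟩
    exact hxY i (hT ht)
  · refine iSup_le fun ℓ => le_inf ?_ ?_
    · exact (Radd_mono (Set.union_subset_union_left _ hYY)).trans
        (le_iSup (fun ℓ : Fin n => Radd X (Y ∪ (Set.range x \ {x ℓ}))) ℓ)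
    · exact Radd_mono (Set.union_subset_union_right _ Set.sdiff_subset)
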